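/- Fix α ∈ (0,1). For every d ≥ 2 and λ ∈ V, there exists a natural number t with t ≤ ⌈(E(λ) + 5/2)·ln(1/α)⌉ such that E(F^(t)(λ)) ≤ α·E(λ). -/

import Mathlib

open Finset

noncomputable section

/-- Membership in the set `V` of valid spectra (zero-indexed: `lam 0` is `λ₁`). -/
def memV {d : ℕ} [NeZero d] (lam : Fin d → ℝ) : Prop :=
  (∀ i, 0 ≤ lam i) ∧ (∀ i j : Fin d, i ≤ j → lam j ≤ lam i) ∧
    lam 1 < lam 0 ∧ ∑ i, lam i = 1

/-- The spectrum map induced by a successful swap test: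
`F(λ)_i = λ_i(λ_i+1)/(1+‖λ‖²)`. -/
def Fmap {d : ℕ} (lam : Fin d → ℝ) : Fin d → ℝ :=
  fun i => lam i * (lam i + 1) / (1 + ∑ j, lam j ^ 2)

/-- `E(λ) = Σ_{j=2}^d λ_j/(λ_1 - λ_j)`. -/
def Evec {d : ℕ} [NeZero d] (lam : Fin d → ℝ) : ℝ :=
  ∑ j ∈ Finset.univ.erase (0 : Fin d), lam j / (lam 0 - lam j)

/-- `η(λ) = 1 - λ₁`. -/
def etaV {d : ℕ} [NeZero d] (lam : Fin d → ℝ) : ℝ := 1 - lam 0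

variable {d : ℕ} [NeZero d] {lam : Fin d → ℝ}

lemma memV.lt_zero (hd : 2 ≤ d) (h : memV lam) {j : Fin d} (hj : j ≠ 0) : lam j < lam 0 := by
  refine (h.2.1 1 j ?_).trans_lt h.2.2.1
  have hj' : (j : ℕ) ≠ 0 := fun h0 => hj (Fin.ext (by simpa using h0))
  rw [Fin.le_def, Fin.val_one', Nat.mod_eq_of_lt hd]
  omega

lemma memV.zero_pos (h : memV lam) : 0 < lam 0 := (h.1 1).trans_lt h.2.2.1

lemma one_add_sum_sq_pos {ι : Type*} [Fintype ι] (v : ι → ℝ) : 0 < 1 + ∑ j, v j ^ 2 := by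
  positivity

lemma memV.map (h : memV lam) : memV (Fmap lam) := by
  obtain ⟨h0, hmono, hlt, hsum⟩ := h
  have hN := one_add_sum_sq_pos lam
  refine ⟨fun i => ?_, fun i j hij => ?_, ?_, ?_⟩
  · exact div_nonneg (mul_nonneg (h0 i) (by linarith [h0 i])) hN.le
  · refine div_le_div_of_nonneg_right ?_ hN.le
    nlinarith [h0 i, h0 j, hmono i j hij]
  · refine div_lt_div_of_pos_right ?_ hN
    nlinarith [h0 0, h0 1]
  · have hnum : ∑ i, lam i * (lam i + 1) = 1 + ∑ j, lam j ^ 2 := by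
      conv_rhs => rw [← hsum, ← Finset.sum_add_distrib]
      exact Finset.sum_congr rfl fun i _ => by ring
    simp only [Fmap]
    rw [← Finset.sum_div, hnum, div_self hN.ne']

lemma memV.iterate (h : memV lam) (t : ℕ) : memV (Fmap^[t] lam) := by
  induction t with
  | zero => exact h
  | succ t ih => rw [Function.iterate_succ_apply']; exact ih.map

lemma memV.term_nonneg (hd : 2 ≤ d) (h : memV lam) {j : Fin d} (hj : j ≠ 0) :
    0 ≤ lam j / (lam 0 - lam j) :=
  div_nonneg (h.1 j) (sub_nonneg.2 (h.lt_zero hd hj).le)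

lemma memV.Evec_nonneg (hd : 2 ≤ d) (h : memV lam) : 0 ≤ Evec lam :=
  Finset.sum_nonneg fun _ hj => h.term_nonneg hd (Finset.ne_of_mem_erase hj)

lemma memV.term_Fmap (hd : 2 ≤ d) (h : memV lam) {j : Fin d} (hj : j ≠ 0) :
    Fmap lam j / (Fmap lam 0 - Fmap lam j) =
      (1 - lam 0 / (1 + lam 0 + lam j)) * (lam j / (lam 0 - lam j)) := by
  have hN := one_add_sum_sq_pos lam
  have hlt := sub_pos.2 (h.lt_zero hd hj)
  have hS : 0 < 1 + lam 0 + lam j := by linarith [h.1 0, h.1 j]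
  have hdiff : lam 0 * (lam 0 + 1) - lam j * (lam j + 1) =
      (lam 0 - lam j) * (1 + lam 0 + lam j) := by ring
  simp only [Fmap]
  rw [← sub_div, div_div_div_cancel_right₀ hN.ne', hdiff]
  field_simp
  ring

/-- `E` dominates `1/λ₁ - 1`, with the excess of any single term to spare. -/
lemma memV.le_Evec (hd : 2 ≤ d) (h : memV lam) {j : Fin d} (hj : j ≠ 0) :
    1 / lam 0 - 1 + (lam j / (lam 0 - lam j) - lam j / lam 0) ≤ Evec lam := by
  have hx := h.zero_pos
  have hsum : ∑ i ∈ Finset.univ.erase (0 : Fin d), lam i / lam 0 = 1 / lam 0 - 1 := by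
    rw [← Finset.sum_div, Finset.sum_erase_eq_sub (Finset.mem_univ _), h.2.2.2, sub_div,
      div_self hx.ne']
  have hsingle := Finset.single_le_sum
    (f := fun i => lam i / (lam 0 - lam i) - lam i / lam 0)
    (s := Finset.univ.erase (0 : Fin d)) (fun i hi => ?_)
    (Finset.mem_erase.2 ⟨hj, Finset.mem_univ j⟩)
  · rw [Finset.sum_sub_distrib, hsum] at hsingle
    simp only [Evec]
    linarith
  · have hlt := h.lt_zero hd (Finset.ne_of_mem_erase hi)
    exact sub_nonneg.2
      (div_le_div_of_nonneg_left (h.1 i) (sub_pos.2 hlt) (by linarith [h.1 i]))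

lemma memV.rate_le (hd : 2 ≤ d) (h : memV lam) {j : Fin d} (hj : j ≠ 0) :
    1 / (Evec lam + 5 / 2) ≤ lam 0 / (1 + lam 0 + lam j) := by
  have hx := h.zero_pos
  have hy := h.1 j
  have hlt := sub_pos.2 (h.lt_zero hd hj)
  have hgap : lam j / lam 0 - 1 / 2 ≤ lam j / (lam 0 - lam j) - lam j / lam 0 := by
    rw [← sub_nonneg]
    have : lam j / (lam 0 - lam j) - lam j / lam 0 - (lam j / lam 0 - 1 / 2) =
        (lam 0 ^ 2 - 3 * lam 0 * lam j + 4 * lam j ^ 2) / (2 * lam 0 * (lam 0 - lam j)) := by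
      field_simp
      ring
    rw [this]
    refine div_nonneg ?_ (by positivity)
    nlinarith [sq_nonneg (lam 0 - 3 / 2 * lam j), sq_nonneg (lam j)]
  have hE := h.le_Evec hd hj
  have hinv : lam 0 / (1 + lam 0 + lam j) = 1 / (1 / lam 0 + 1 + lam j / lam 0) := by
    field_simp
  rw [hinv]
  exact one_div_le_one_div_of_le (by positivity) (by linarith)

lemma memV.Evec_Fmap_le (hd : 2 ≤ d) (h : memV lam) :
    Evec (Fmap lam) ≤ (1 - 1 / (Evec lam + 5 / 2)) * Evec lam := by
  conv_rhs => rw [Evec.eq_1 lam, Finset.mul_sum, ← Evec.eq_1 lam]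
  refine Finset.sum_le_sum fun j hj => ?_
  have hj0 := Finset.ne_of_mem_erase hj
  rw [h.term_Fmap hd hj0]
  exact mul_le_mul_of_nonneg_right (by linarith [h.rate_le hd hj0]) (h.term_nonneg hd hj0)

lemma memV.Evec_iterate_le (hd : 2 ≤ d) (h : memV lam) (t : ℕ) :
    Evec (Fmap^[t] lam) ≤ Real.exp (-(t / (Evec lam + 5 / 2))) * Evec lam := by
  have hE := h.Evec_nonneg hd
  induction t with
  | zero => simp
  | succ t ih =>
    have hV := h.iterate t
    have hE' := hV.Evec_nonneg hd
    have hle : Evec (Fmap^[t] lam) ≤ Evec lam := by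
      refine ih.trans (mul_le_of_le_one_left hE (Real.exp_le_one_iff.2 ?_))
      exact neg_nonpos.2 (by positivity)
    have hrate : 1 / (Evec lam + 5 / 2) ≤ 1 / (Evec (Fmap^[t] lam) + 5 / 2) :=
      one_div_le_one_div_of_le (by linarith) (by linarith)
    rw [Function.iterate_succ_apply']
    calc Evec (Fmap (Fmap^[t] lam))
        ≤ (1 - 1 / (Evec (Fmap^[t] lam) + 5 / 2)) * Evec (Fmap^[t] lam) :=
          hV.Evec_Fmap_le hd
      _ ≤ Real.exp (-(1 / (Evec lam + 5 / 2))) * Evec (Fmap^[t] lam) := by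
          refine mul_le_mul_of_nonneg_right ?_ hE'
          linarith [Real.add_one_le_exp (-(1 / (Evec lam + 5 / 2)))]
      _ ≤ Real.exp (-(1 / (Evec lam + 5 / 2))) *
            (Real.exp (-(t / (Evec lam + 5 / 2))) * Evec lam) := by gcongr
      _ = Real.exp (-((t + 1 : ℕ) / (Evec lam + 5 / 2))) * Evec lam := by
          rw [← mul_assoc, ← Real.exp_add]
          push_cast
          ring_nf

/-- number of levels needed to cut `E` by a constant factor `α`. -/
theorem stmt13 (α : ℝ) (hα : α ∈ Set.Ioo (0:ℝ) 1)
    (d : ℕ) [NeZero d] (hd : 2 ≤ d) (lam : Fin d → ℝ) (hV : memV lam) :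
    ∃ t : ℕ, (t : ℤ) ≤ ⌈(Evec lam + 5/2) * Real.log (1/α)⌉ ∧
      Evec (Fmap^[t] lam) ≤ α * Evec lam := by
  have hE := hV.Evec_nonneg hd
  have hK : 0 < Evec lam + 5 / 2 := by linarith
  have hlog : 0 ≤ Real.log (1 / α) :=
    Real.log_nonneg ((one_le_div hα.1).2 hα.2.le)
  refine ⟨⌈(Evec lam + 5 / 2) * Real.log (1 / α)⌉₊,
    (Int.natCast_ceil_eq_ceil (by positivity)).le, ?_⟩
  refine (hV.Evec_iterate_le hd _).trans (mul_le_mul_of_nonneg_right ?_ hE)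
  have ht := Nat.le_ceil ((Evec lam + 5 / 2) * Real.log (1 / α))
  rw [← Real.le_log_iff_exp_le hα.1]
  have := (le_div_iff₀' hK).2 ht
  rw [one_div, Real.log_inv] at this
  rw [one_div, Real.log_inv]
  linarith
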